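/- arXiv:1011.5652 — 3 statements merged into one kernel-verified Lean document; each statement's English description precedes it below -/
import Mathlib

section
/- Let p be a prime and let n₁, n₂ be positive integers with n₁ = p^{j₁}·m₁ and n₂ = p^{j₂}·m₂, where p does not divide m₁ or m₂ and j₁ ≠ j₂. Then for all integers k₁, k₂ ≥ 1, the images of Φ_{n₁}(q)^{k₁} and Φ_{n₂}(q)^{k₂} generate the unit ideal of ℤ[1/p][q]; consequently, by the Chinese remainder theorem, ℤ[1/p][q]/(Φ_{n₁}(q)^{k₁}·Φ_{n₂}(q)^{k₂}) is isomorphic as a ring to the product ℤ[1/p][q]/(Φ_{n₁}(q)^{k₁}) × ℤ[1/p][q]/(Φ_{n₂}(q)^{k₂}). -/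
open Polynomial

theorem X_pow_sub_one_mul_cyclotomic_dvd_of_dvd_of_not_dvd (R : Type*) [CommRing R] {d e n : ℕ}
    (hn : 0 < n) (hd : d ∣ n) (he : e ∣ n) (hed : ¬ e ∣ d) :
    (X ^ d - 1) * cyclotomic e R ∣ X ^ n - 1 := by
  have hd0 : 0 < d := Nat.pos_of_dvd_of_pos hd hn
  rw [← prod_cyclotomic_eq_X_pow_sub_one hd0, ← prod_cyclotomic_eq_X_pow_sub_one hn, mul_comm,
    ← Finset.prod_insert (f := fun i => cyclotomic i R) (fun h => hed (Nat.dvd_of_mem_divisors h))]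
  refine Finset.prod_dvd_prod_of_subset _ _ _ (Finset.insert_subset ?_ ?_)
  · exact Nat.mem_divisors.2 ⟨he, hn.ne'⟩
  · exact Nat.divisors_subset_of_dvd hn.ne' hd

theorem isCoprime_sub_one_geom_sum {S : Type*} [CommRing S] (y : S) {p : ℕ}
    (hp : IsUnit (p : S)) : IsCoprime (y - 1) (∑ i ∈ Finset.range p, y ^ i) := by
  obtain ⟨c, hc⟩ : y - 1 ∣ (∑ i ∈ Finset.range p, y ^ i) - (p : S) := by
    have h : (∑ i ∈ Finset.range p, y ^ i) - (p : S) = ∑ i ∈ Finset.range p, (y ^ i - 1) := by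
      simp
    rw [h]
    exact Finset.dvd_sum fun i _ => sub_one_dvd_pow_sub_one y i
  obtain ⟨u, hu⟩ := hp.exists_left_inv
  exact ⟨-(u * c), u, by linear_combination u * hc + hu⟩

theorem isCoprime_cyclotomic_of_lt {R : Type*} [CommRing R] {p j₁ j₂ m₁ m₂ : ℕ} (hp : p.Prime)
    (hpR : IsUnit (p : R)) (hm₁ : 0 < m₁) (hm₂ : 0 < m₂) (hpm₁ : ¬ p ∣ m₁) (hpm₂ : ¬ p ∣ m₂)
    (hj : j₁ < j₂) :
    IsCoprime (cyclotomic (p ^ j₁ * m₁) R) (cyclotomic (p ^ j₂ * m₂) R) := by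
  obtain ⟨j, rfl⟩ : ∃ j, j₂ = j + 1 := ⟨j₂ - 1, by omega⟩
  set d := p ^ j * (m₁ * m₂) with hd
  have hd0 : 0 < d := by have := hp.pos; positivity
  have h₁ : cyclotomic (p ^ j₁ * m₁) R ∣ X ^ d - 1 :=
    (cyclotomic.dvd_X_pow_sub_one _ R).trans (dvd_pow_sub_one_of_dvd
      (mul_dvd_mul (pow_dvd_pow p (by omega)) (dvd_mul_right m₁ m₂)))
  have hnd : ¬ p ^ (j + 1) * m₂ ∣ d := fun h => by
    have h' : p ^ j * p ∣ p ^ j * (m₁ * m₂) := pow_succ p j ▸ (dvd_mul_right _ _).trans h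
    rcases hp.dvd_mul.1 (Nat.dvd_of_mul_dvd_mul_left (pow_pos hp.pos j) h') with h | h
    exacts [hpm₁ h, hpm₂ h]
  have h₂ : cyclotomic (p ^ (j + 1) * m₂) R ∣ ∑ i ∈ Finset.range p, (X ^ d : R[X]) ^ i := by
    have h := X_pow_sub_one_mul_cyclotomic_dvd_of_dvd_of_not_dvd R (n := d * p)
      (Nat.mul_pos hd0 hp.pos) (dvd_mul_right d p) ⟨m₁, by rw [hd]; ring⟩ hnd
    rw [pow_mul X d p, ← mul_geom_sum (X ^ d)] at h
    have hmonic : (X ^ d - 1 : R[X]).Monic := by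
      simpa using monic_X_pow_sub_C (1 : R) hd0.ne'
    obtain ⟨c, hc⟩ := h
    rw [mul_assoc] at hc
    exact ⟨c, hmonic.isRegular.left hc⟩
  have hpX : IsUnit (p : R[X]) := by simpa using hpR.map (C : R →+* R[X])
  exact ((isCoprime_sub_one_geom_sum _ hpX).of_isCoprime_of_dvd_left h₁).of_isCoprime_of_dvd_right
    h₂

theorem stmt_5 (p : ℕ) (hp : p.Prime) (j₁ j₂ m₁ m₂ : ℕ)
    (hm₁ : 0 < m₁) (hm₂ : 0 < m₂) (hpm₁ : ¬ p ∣ m₁) (hpm₂ : ¬ p ∣ m₂)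
    (hj : j₁ ≠ j₂) (k₁ k₂ : ℕ) (hk₁ : 1 ≤ k₁) (hk₂ : 1 ≤ k₂)
    (R : Type) [CommRing R] [Algebra ℤ R] [IsLocalization.Away (p : ℤ) R] :
    IsCoprime ((cyclotomic (p ^ j₁ * m₁) R) ^ k₁)
              ((cyclotomic (p ^ j₂ * m₂) R) ^ k₂) ∧
    Nonempty
      ((R[X] ⧸ Ideal.span {(cyclotomic (p ^ j₁ * m₁) R) ^ k₁ *
                           (cyclotomic (p ^ j₂ * m₂) R) ^ k₂}) ≃+*
        (R[X] ⧸ Ideal.span {(cyclotomic (p ^ j₁ * m₁) R) ^ k₁}) ×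
        (R[X] ⧸ Ideal.span {(cyclotomic (p ^ j₂ * m₂) R) ^ k₂})) := by
  have hpR : IsUnit (p : R) := by
    simpa using IsLocalization.Away.algebraMap_isUnit (S := R) (p : ℤ)
  have hcop : IsCoprime ((cyclotomic (p ^ j₁ * m₁) R) ^ k₁)
      ((cyclotomic (p ^ j₂ * m₂) R) ^ k₂) := by
    refine IsCoprime.pow ?_
    rcases hj.lt_or_gt with h | h
    · exact isCoprime_cyclotomic_of_lt hp hpR hm₁ hm₂ hpm₁ hpm₂ h
    · exact (isCoprime_cyclotomic_of_lt hp hpR hm₂ hm₁ hpm₂ hpm₁ h).symm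
  refine ⟨hcop, ⟨(Ideal.quotEquivOfEq ?_).trans (Ideal.quotientMulEquivQuotientProd _ _
    ((Ideal.isCoprime_span_singleton_iff _ _).2 hcop))⟩⟩
  rw [Ideal.span_singleton_mul_span_singleton]
end

section
/- Let r be an odd positive integer, let ξ ∈ ℂ be a primitive r-th root of unity, let b be a nonzero integer and a an integer. Set c = gcd(b, r), and let β be any integer with β·(b/c) ≡ 1 (mod r/c). Then the sum over odd n with 0 ≤ n ≤ 2r−1 of ξ^{b(n²−1)/4 + n a} equals 0 if c does not divide a, and equals ξ^{−c·a₁²·β} · (∑_{n odd, 0 ≤ n ≤ 2r−1} ξ^{b(n²−1)/4}) if a = c·a₁ for an integer a₁. (The value ξ^{−c·a₁²·β} does not depend on the choice of β.) -/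
open Finset

theorem Function.Periodic.sum_range_add_int {M : Type*} [AddCommGroup M] {f : ℤ → M} {r : ℕ}
    (hf : Function.Periodic f (r : ℤ)) (t : ℤ) :
    ∑ k ∈ range r, f (k + t) = ∑ k ∈ range r, f k := by
  have step (s : ℤ) : ∑ k ∈ range r, f (k + (s + 1)) = ∑ k ∈ range r, f (k + s) := by
    have h₁ := sum_range_succ (fun k : ℕ => f (k + s)) r
    have h₂ := sum_range_succ' (fun k : ℕ => f (k + s)) r
    have h₃ : f ((r : ℤ) + s) = f s := by rw [add_comm, hf]
    simp only [h₃, Nat.cast_zero, zero_add] at h₁ h₂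
    have h₄ := add_right_cancel (h₁.symm.trans h₂)
    rw [h₄]
    refine sum_congr rfl fun k _ => ?_
    push_cast
    ring_nf
  induction t with
  | zero => simp
  | succ i ih => rw [step, ih]
  | pred i ih => rw [← ih, ← step, sub_add_cancel]

theorem Finset.sum_range_two_mul_filter_odd {M : Type*} [AddCommMonoid M] (f : ℕ → M) (r : ℕ) :
    ∑ n ∈ (range (2 * r)).filter (fun n => Odd n), f n = ∑ k ∈ range r, f (2 * k + 1) := by
  symm
  refine sum_bij (fun k _ => 2 * k + 1) ?_ ?_ ?_ ?_
  · intro k hk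
    simp only [mem_filter, mem_range] at hk ⊢
    exact ⟨by omega, k, rfl⟩
  · intro k _ l _ h
    omega
  · intro n hn
    simp only [mem_filter, mem_range] at hn
    obtain ⟨h, k, rfl⟩ := hn
    exact ⟨k, by simp only [mem_range]; omega, rfl⟩
  · intro _ _
    rfl

theorem Int.odd_sq_sub_one_ediv_four (k : ℤ) : ((2 * k + 1) ^ 2 - 1) / 4 = k * (k + 1) := by
  rw [show (2 * k + 1) ^ 2 - 1 = 4 * (k * (k + 1)) by ring]
  exact Int.mul_ediv_cancel_left _ (by norm_num)

theorem IsPrimitiveRoot.zpow_eq_zpow_of_dvd_sub {K : Type*} [Field K] {ξ : K} {r : ℕ}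
    (hξ : IsPrimitiveRoot ξ r) (hr : 0 < r) {m n : ℤ} (h : (r : ℤ) ∣ m - n) :
    ξ ^ m = ξ ^ n := by
  rw [← sub_add_cancel m n, zpow_add₀ (hξ.ne_zero hr.ne'), (hξ.zpow_eq_one_iff_dvd _).2 h, one_mul]

/-- Translating the summation variable by `2 * t` in an odd quadratic Gauss sum replaces the linear
coefficient `a` by any `a'` congruent to `b * t + a` modulo `r`, up to a power of `ξ`. -/
theorem IsPrimitiveRoot.sum_odd_quadratic_translate {K : Type*} [Field K] {ξ : K} {r : ℕ}
    (hξ : IsPrimitiveRoot ξ r) (hr : 0 < r) {a a' b d t : ℤ} (ha : (r : ℤ) ∣ b * t + a - a')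
    (hd : (r : ℤ) ∣ t * (a + a') - d) :
    ∑ n ∈ (range (2 * r)).filter (fun n => Odd n),
        ξ ^ (b * (((n : ℤ) ^ 2 - 1) / 4) + (n : ℤ) * a) =
      ξ ^ d * ∑ n ∈ (range (2 * r)).filter (fun n => Odd n),
        ξ ^ (b * (((n : ℤ) ^ 2 - 1) / 4) + (n : ℤ) * a') := by
  simp only [sum_range_two_mul_filter_odd, Nat.cast_add, Nat.cast_mul, Nat.cast_ofNat,
    Nat.cast_one, Int.odd_sq_sub_one_ediv_four]
  have hper : Function.Periodic (fun k : ℤ => ξ ^ (b * (k * (k + 1)) + (2 * k + 1) * a)) r := by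
    intro k
    refine hξ.zpow_eq_zpow_of_dvd_sub hr ⟨b * (2 * k + 1 + r) + 2 * a, ?_⟩
    ring
  rw [← hper.sum_range_add_int t, mul_sum]
  refine sum_congr rfl fun k _ => ?_
  rw [← zpow_add₀ (hξ.ne_zero hr.ne')]
  refine hξ.zpow_eq_zpow_of_dvd_sub hr ?_
  obtain ⟨u, hu⟩ := ha
  obtain ⟨v, hv⟩ := hd
  refine ⟨(2 * k + 1 + t) * u + v, ?_⟩
  linear_combination (2 * (k : ℤ) + 1 + t) * hu + hv

theorem stmt_10 (r : ℕ) (hr : Odd r) (hr0 : 0 < r) (ξ : ℂ)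
    (hξ : IsPrimitiveRoot ξ r) (b a β : ℤ) (hb : b ≠ 0)
    (hβ : β * (b / (Int.gcd b r : ℤ)) ≡ 1 [ZMOD ((r : ℤ) / (Int.gcd b r : ℤ))]) :
    (¬ ((Int.gcd b r : ℤ) ∣ a) →
      ∑ n ∈ (Finset.range (2 * r)).filter (fun n => Odd n),
          ξ ^ (b * (((n : ℤ) ^ 2 - 1) / 4) + (n : ℤ) * a) = 0) ∧
    (∀ a₁ : ℤ, a = (Int.gcd b r : ℤ) * a₁ →
      ∑ n ∈ (Finset.range (2 * r)).filter (fun n => Odd n),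
          ξ ^ (b * (((n : ℤ) ^ 2 - 1) / 4) + (n : ℤ) * a) =
        ξ ^ (-((Int.gcd b r : ℤ) * a₁ ^ 2 * β)) *
          ∑ n ∈ (Finset.range (2 * r)).filter (fun n => Odd n),
            ξ ^ (b * (((n : ℤ) ^ 2 - 1) / 4))) := by
  have hbc : (Int.gcd b r : ℤ) * (b / (Int.gcd b r : ℤ)) = b :=
    Int.mul_ediv_cancel' (Int.gcd_dvd_left ..)
  have hrc : (Int.gcd b r : ℤ) * ((r : ℤ) / (Int.gcd b r : ℤ)) = r :=
    Int.mul_ediv_cancel' (Int.gcd_dvd_right ..)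
  generalize (Int.gcd b r : ℤ) = c at *
  generalize b / c = b' at *
  generalize (r : ℤ) / c = m at *
  constructor
  · intro hca
    have key := hξ.sum_odd_quadratic_translate hr0 (a := a) (a' := a) (b := b) (d := 2 * (m * a))
      (t := m) ⟨b', by linear_combination (-m) * hbc + b' * hrc⟩ ⟨0, by ring⟩
    by_contra hS
    have h1 : ξ ^ (2 * (m * a)) = 1 := mul_right_cancel₀ hS (key.symm.trans (one_mul _).symm)
    rw [hξ.zpow_eq_one_iff_dvd] at h1
    have hcop : IsCoprime (r : ℤ) 2 := by
      exact_mod_cast Nat.isCoprime_iff_coprime.2 hr.coprime_two_right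
    have h2 := hcop.dvd_of_dvd_mul_left h1
    have hm : m ≠ 0 := by
      rintro rfl
      simp at hrc
      omega
    rw [← hrc, mul_comm c m] at h2
    exact hca ((mul_dvd_mul_iff_left hm).1 h2)
  · rintro a₁ rfl
    obtain ⟨u, hu⟩ := hβ.dvd
    have key := hξ.sum_odd_quadratic_translate hr0 (a := c * a₁) (a' := 0) (b := b)
      (d := -(c * a₁ ^ 2 * β)) (t := -(a₁ * β))
      ⟨a₁ * u, by linear_combination (a₁ * β) * hbc + c * a₁ * hu + a₁ * u * hrc⟩ ⟨0, by ring⟩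
    simpa only [mul_zero, add_zero] using key
end

section
/- (Gauss sum reciprocity in one dimension) Let m and n be positive integers and ψ, φ integers with φ ≠ 0, such that n·m is even and φ divides n·ψ. Then ∑_{λ=0}^{n−1} exp(2πi·m·λ²/(2n)) · exp(2πi·ψ·λ/φ) = (1+i)·√(n/(2m)) · ∑_{λ=0}^{m−1} exp(−2πi·n·(λφ+ψ)²/(2mφ²)). -/
open Finset

/-- The Jacobi theta function at a real first argument tends to `1` at the cusp `i∞`. -/
lemma tendsto_jacobiTheta₂_one {ι : Type*} {l : Filter ι} (x : ℝ) {τ : ι → ℂ}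
    (h : Filter.Tendsto (fun i ↦ (τ i).im) l Filter.atTop) :
    Filter.Tendsto (fun i ↦ jacobiTheta₂ x (τ i)) l (nhds 1) := by
  have hb := summable_pow_mul_jacobiTheta₂_term_bound 0 one_pos 0
  have key := tendsto_tsum_of_dominated_convergence (𝓕 := l)
    (f := fun i k ↦ jacobiTheta₂_term k x (τ i)) (g := fun k : ℤ ↦ if k = 0 then (1 : ℂ) else 0)
    hb ?_ ?_
  · simpa [jacobiTheta₂, tsum_ite_eq] using key
  · intro k
    split_ifs with hk
    · simpa [hk, jacobiTheta₂_term] using tendsto_const_nhds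
    · rw [tendsto_zero_iff_norm_tendsto_zero]
      simp only [norm_jacobiTheta₂_term, Complex.ofReal_im, mul_zero, sub_zero]
      refine Real.tendsto_exp_atBot.comp ?_
      refine h.const_mul_atTop_of_neg ?_
      have : (0 : ℝ) < (k : ℝ) ^ 2 := by positivity
      nlinarith [Real.pi_pos]
  · filter_upwards [h.eventually_ge_atTop 1] with i hi k
    simpa using norm_jacobiTheta₂_term_le (S := 0) one_pos (z := (x : ℂ)) (by simp) hi k

lemma Function.Periodic.exists_norm_le {E : Type*} [NormedAddCommGroup E] {N : ℕ} (hN : 0 < N)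
    {g : ℤ → E} (hg : Function.Periodic g (N : ℤ)) : ∃ C, ∀ k, ‖g k‖ ≤ C := by
  refine ⟨∑ r ∈ range N, ‖g r‖, fun k ↦ ?_⟩
  have hN' : (0 : ℤ) < N := by exact_mod_cast hN
  have h0 := Int.emod_nonneg k hN'.ne'
  have h1 := Int.emod_lt_of_pos k hN'
  have h2 : g k = g ((k % N).toNat : ℤ) := by
    rw [Int.toNat_of_nonneg h0, Int.emod_def, mul_comm]
    exact (hg.sub_int_mul_eq (k / N)).symm
  rw [h2]
  exact single_le_sum (f := fun r : ℕ ↦ ‖g r‖) (fun _ _ ↦ norm_nonneg _)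
    (mem_range.2 (by lia))

/-- Gaussian sums twisted by a periodic function are linear combinations of theta functions. -/
lemma tsum_periodic_mul_cexp_sq {N : ℕ} (hN : 0 < N) {g : ℤ → ℂ}
    (hg : Function.Periodic g (N : ℤ)) (c : ℂ) {w : ℂ} (hw : 0 < w.im) :
    ∑' k : ℤ, g k * Complex.exp (Real.pi * Complex.I * w * (k + c) ^ 2) =
      1 / (-Complex.I * (N ^ 2 * w)) ^ (1 / 2 : ℂ) *
        ∑ r ∈ range N, g r * jacobiTheta₂ ((r + c) / N) (-1 / (N ^ 2 * w)) := by
  have : NeZero N := ⟨hN.ne'⟩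
  have hN0 : (N : ℂ) ≠ 0 := by exact_mod_cast hN.ne'
  have hw0 : w ≠ 0 := by rintro rfl; simp at hw
  have hsum : Summable fun k : ℤ ↦
      g k * Complex.exp (Real.pi * Complex.I * w * (k + c) ^ 2) := by
    obtain ⟨C, hC⟩ := hg.exists_norm_le hN
    have h1 := (((summable_jacobiTheta₂_term_iff (w * c) w).2 hw).mul_left
      (Complex.exp (Real.pi * Complex.I * w * c ^ 2))).norm.mul_left C
    refine h1.of_norm_bounded fun k ↦ ?_
    rw [norm_mul, jacobiTheta₂_term, ← Complex.exp_add]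
    refine mul_le_mul (hC k) (le_of_eq ?_) (norm_nonneg _) ((norm_nonneg _).trans (hC k))
    congr 2
    ring
  let e := (Equiv.prodComm (Fin N) ℤ).trans (Int.divModEquiv N).symm
  have he (r : Fin N) (j : ℤ) : e (r, j) = j * N + r := rfl
  have hsum' := (e.summable_iff.2 hsum).tsum_prod
  simp only [Function.comp_apply] at hsum'
  rw [← e.tsum_eq, hsum', tsum_fintype, mul_sum, ← Fin.sum_univ_eq_sum_range (fun r ↦ _ * (g r * jacobiTheta₂ _ _))]
  refine sum_congr rfl fun r _ ↦ ?_
  have h2 := jacobiTheta₂_functional_equation (N * w * (r + c)) (N ^ 2 * w)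
  have e1 : N * w * (r + c) / (N ^ 2 * w) = (r + c) / (N : ℂ) := by field_simp
  have e2 : -Real.pi * Complex.I * (N * w * (r + c)) ^ 2 / (N ^ 2 * w) =
    -(Real.pi * Complex.I * w * ((r : ℕ) + c) ^ 2) := by field_simp
  rw [e1, e2, Complex.exp_neg] at h2
  have h3 : 1 / (-Complex.I * (N ^ 2 * w)) ^ (1 / 2 : ℂ) *
      jacobiTheta₂ ((r + c) / N) (-1 / (N ^ 2 * w)) =
      Complex.exp (Real.pi * Complex.I * w * ((r : ℕ) + c) ^ 2) *
        jacobiTheta₂ (N * w * (r + c)) (N ^ 2 * w) := by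
    rw [h2]
    field_simp [Complex.exp_ne_zero]
  rw [mul_left_comm, h3, jacobiTheta₂, ← tsum_mul_left, ← tsum_mul_left]
  refine tsum_congr fun j ↦ ?_
  rw [he, jacobiTheta₂_term, ← Complex.exp_add]
  congr 1
  · have := hg.int_mul j r
    rw [add_comm]
    simpa using this
  · congr 1
    push_cast
    ring

lemma Complex.ofReal_mul_cpow {s : ℝ} (hs : 0 < s) {z : ℂ} (hz : z ≠ 0) (r : ℂ) :
    ((s : ℂ) * z) ^ r = (s : ℂ) ^ r * z ^ r := by
  have hs' : (s : ℂ) ≠ 0 := by exact_mod_cast hs.ne'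
  rw [cpow_def_of_ne_zero (mul_ne_zero hs' hz), cpow_def_of_ne_zero hs', cpow_def_of_ne_zero hz,
    log_ofReal_mul hs hz, add_mul, exp_add, ofReal_log hs.le]

/-- Reciprocity for quadratic Gauss sums smoothed by theta functions. -/
lemma sum_cexp_mul_jacobiTheta₂_reciprocity {m n : ℕ} (hm : 0 < m) (hn : 0 < n) {b : ℝ} {q : ℤ}
    (hb : n * b = q) (heven : Even (n * m)) {t : ℝ} (ht : 0 < t) :
    ∑ r ∈ range n, Complex.exp (Real.pi * Complex.I * (m / n * r ^ 2 + 2 * b * r)) *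
        jacobiTheta₂ ((r / n : ℝ) : ℂ) (Complex.I * (1 / (n ^ 2 * t) : ℝ)) =
      1 / (-Complex.I * (m / n + Complex.I * t)) ^ (1 / 2 : ℂ) *
        (1 / (m / (m + n * t * Complex.I)) ^ (1 / 2 : ℂ) *
          ∑ r ∈ range m, Complex.exp (-(Real.pi * Complex.I * (n / m) * (r + b) ^ 2)) *
            jacobiTheta₂ (((r + b) / m : ℝ) : ℂ)
              (Complex.I * (1 / (n ^ 2 * t) : ℝ) - (1 / (m * n) : ℝ))) := by
  have hI := Complex.I_sq
  have hm0 : (m : ℂ) ≠ 0 := by exact_mod_cast hm.ne'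
  have hn0 : (n : ℂ) ≠ 0 := by exact_mod_cast hn.ne'
  have ht0 : (t : ℂ) ≠ 0 := by exact_mod_cast ht.ne'
  have hmR : (0 : ℝ) < m := by exact_mod_cast hm
  have hnR : (0 : ℝ) < n := by exact_mod_cast hn
  have hbC : (n : ℂ) * b = q := by exact_mod_cast hb
  obtain ⟨s, hs⟩ := heven
  have hsC : (n : ℂ) * m = s + s := by exact_mod_cast hs
  set τ : ℂ := m / n + Complex.I * t with hτ
  have hτi : τ.im = t := by
    have : τ = ((m / n : ℝ) : ℂ) + Complex.I * t := by push_cast; rfl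
    simp [this]
  have hτ0 : τ ≠ 0 := by
    intro h
    rw [h] at hτi
    exact ht.ne hτi
  have hd : (m : ℂ) + n * t * Complex.I = n * τ := by rw [hτ]; field_simp
  have hd0 : (m : ℂ) + n * t * Complex.I ≠ 0 := hd ▸ mul_ne_zero hn0 hτ0
  set P : ℂ := ((n ^ 2 * t : ℝ) : ℂ) ^ (1 / 2 : ℂ) with hP
  have hP0 : P ≠ 0 := by
    rw [hP, Ne, Complex.cpow_eq_zero_iff]
    rintro ⟨h, -⟩
    have : (n : ℝ) ^ 2 * t ≠ 0 := by positivity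
    exact this (by exact_mod_cast h)
  have hleft : P * jacobiTheta₂ b τ =
      ∑ r ∈ range n, Complex.exp (Real.pi * Complex.I * (m / n * r ^ 2 + 2 * b * r)) *
        jacobiTheta₂ ((r / n : ℝ) : ℂ) (Complex.I * (1 / (n ^ 2 * t) : ℝ)) := by
    have h := tsum_periodic_mul_cexp_sq hn (c := 0) (w := Complex.I * t)
      (g := fun k ↦ Complex.exp (Real.pi * Complex.I * (m / n * k ^ 2 + 2 * b * k))) ?_
      (by simpa using ht)
    · have e1 : -Complex.I * ((n : ℂ) ^ 2 * (Complex.I * t)) = ((n ^ 2 * t : ℝ) : ℂ) := by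
        push_cast; linear_combination (-(n : ℂ) ^ 2 * t) * hI
      have e2 : -1 / ((n : ℂ) ^ 2 * (Complex.I * t)) = Complex.I * (1 / (n ^ 2 * t) : ℝ) := by
        push_cast; field_simp; rw [hI]
      have e3 : jacobiTheta₂ b τ = ∑' k : ℤ,
          Complex.exp (Real.pi * Complex.I * (m / n * k ^ 2 + 2 * b * k)) *
            Complex.exp (Real.pi * Complex.I * (Complex.I * t) * (k + 0) ^ 2) := by
        rw [jacobiTheta₂]
        refine tsum_congr fun k ↦ ?_
        rw [jacobiTheta₂_term, ← Complex.exp_add, hτ]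
        congr 1
        ring
      rw [e3, h, e1, e2, ← hP, ← mul_assoc, mul_one_div_cancel hP0, one_mul]
      simp
    · intro k
      refine Complex.exp_eq_exp_iff_exists_int.2 ⟨k * m + s + q, ?_⟩
      push_cast
      field_simp
      linear_combination (n : ℂ) * hsC + 2 * (n : ℂ) * hbC
  have hright : P * jacobiTheta₂ b τ = 1 / (-Complex.I * τ) ^ (1 / 2 : ℂ) *
        (1 / (m / (m + n * t * Complex.I)) ^ (1 / 2 : ℂ) *
          ∑ r ∈ range m, Complex.exp (-(Real.pi * Complex.I * (n / m) * (r + b) ^ 2)) *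
            jacobiTheta₂ (((r + b) / m : ℝ) : ℂ)
              (Complex.I * (1 / (n ^ 2 * t) : ℝ) - (1 / (m * n) : ℝ))) := by
    have hw : 0 < ((n / m : ℂ) - 1 / τ).im := by
      have e : (n / m : ℂ) = ((n / m : ℝ) : ℂ) := by push_cast; rfl
      rw [e, Complex.sub_im, Complex.ofReal_im, one_div, Complex.inv_im, hτi]
      have := Complex.normSq_pos.2 hτ0
      have : 0 < t / Complex.normSq τ := by positivity
      rw [neg_div]; linarith
    have h := tsum_periodic_mul_cexp_sq hm (c := b) (w := n / m - 1 / τ)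
      (g := fun k ↦ Complex.exp (-(Real.pi * Complex.I * (n / m) * (k + b) ^ 2))) ?_ hw
    · have e0 : (m : ℂ) ^ 2 * (n / m - 1 / τ) =
          Complex.I * ((n ^ 2 * t : ℝ) * (m / (m + n * t * Complex.I))) := by
        rw [hd]; push_cast; field_simp; rw [hτ]; field_simp; ring
      have e1 : -Complex.I * ((m : ℂ) ^ 2 * (n / m - 1 / τ)) =
          (n ^ 2 * t : ℝ) * (m / (m + n * t * Complex.I)) := by
        rw [e0]; linear_combination (-((n ^ 2 * t : ℝ) * (m / (m + n * t * Complex.I)))) * hI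
      have e2 : -1 / ((m : ℂ) ^ 2 * (n / m - 1 / τ)) =
          Complex.I * (1 / (n ^ 2 * t) : ℝ) - (1 / (m * n) : ℝ) := by
        rw [e0]; push_cast; field_simp; linear_combination (-(m : ℂ)) * hI
      have e3 : Complex.exp (-Real.pi * Complex.I * b ^ 2 / τ) * jacobiTheta₂ (b / τ) (-1 / τ) =
          ∑' k : ℤ, Complex.exp (-(Real.pi * Complex.I * (n / m) * (k + b) ^ 2)) *
            Complex.exp (Real.pi * Complex.I * (n / m - 1 / τ) * (k + b) ^ 2) := by
        rw [← jacobiTheta₂_neg_left, jacobiTheta₂, ← tsum_mul_left]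
        refine tsum_congr fun k ↦ ?_
        rw [jacobiTheta₂_term, ← Complex.exp_add, ← Complex.exp_add]
        congr 1
        ring
      rw [jacobiTheta₂_functional_equation, mul_assoc (1 / _), e3, h, e1, e2,
        Complex.ofReal_mul_cpow (by positivity) (div_ne_zero hm0 hd0), ← hP]
      have e4 : ∀ X A B : ℂ, P * (1 / A * (1 / (P * B) * X)) = 1 / A * (1 / B * X) := by
        intro X A B
        field_simp
      rw [e4]
      simp
    · intro k
      refine Complex.exp_eq_exp_iff_exists_int.2 ⟨-(n * k + q + s), ?_⟩
      push_cast
      field_simp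
      linear_combination (-(m : ℂ)) * hsC - 2 * (m : ℂ) * hbC
  rw [← hleft, hright]

lemma Complex.one_div_neg_I_mul_cpow_half {x : ℝ} (hx : 0 < x) :
    1 / (-I * x) ^ (1 / 2 : ℂ) = (1 + I) * (Real.sqrt (1 / (2 * x)) : ℂ) := by
  have h0 : 0 < √(x / 2) := Real.sqrt_pos.2 (by positivity)
  have h1 : √(1 / (2 * x)) * √(x / 2) = 1 / 2 := by
    rw [← Real.sqrt_mul (by positivity),
      show 1 / (2 * x) * (x / 2) = (1 / 2 : ℝ) ^ 2 by field_simp,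
      Real.sqrt_sq (by norm_num)]
  have h1' : (√(1 / (2 * x)) : ℂ) * (√(x / 2) : ℂ) = 1 / 2 := by
    rw [← ofReal_mul, h1]
    norm_num
  have h2 : (√(x / 2) : ℂ) ^ 2 = x / 2 := by exact_mod_cast Real.sq_sqrt (by positivity)
  have h3 : -I * x = ((1 - I) * (√(x / 2) : ℂ)) ^ 2 := by
    rw [mul_pow, h2]; linear_combination (-(x : ℂ) / 2) * I_sq
  have h4 : 0 < ((1 - I) * (√(x / 2) : ℂ)).re := by simpa using h0
  have h5 : (1 - I) * (√(x / 2) : ℂ) ≠ 0 := by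
    intro h
    rw [h] at h4
    exact lt_irrefl _ h4
  rw [h3, one_div (2 : ℂ), sq_cpow_two_inv h4, div_eq_iff h5]
  linear_combination (-(1 - I ^ 2)) * h1' + (1 / 2) * I_sq

/-- Reciprocity for quadratic Gauss sums with a linear term. -/
lemma sum_cexp_quadratic_reciprocity {m n : ℕ} (hm : 0 < m) (hn : 0 < n) {b : ℝ} {q : ℤ}
    (hb : n * b = q) (heven : Even (n * m)) :
    ∑ r ∈ range n, Complex.exp (Real.pi * Complex.I * (m / n * r ^ 2 + 2 * b * r)) =
      (1 + Complex.I) * (Real.sqrt ((n : ℝ) / (2 * m)) : ℂ) *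
        ∑ r ∈ range m, Complex.exp (-(Real.pi * Complex.I * (n / m) * (r + b) ^ 2)) := by
  have hmR : (0 : ℝ) < m := by exact_mod_cast hm
  have hnR : (0 : ℝ) < n := by exact_mod_cast hn
  have hm0 : (m : ℂ) ≠ 0 := by exact_mod_cast hm.ne'
  have hinf : Filter.Tendsto (fun t : ℝ ↦ 1 / (n ^ 2 * t)) (nhdsWithin 0 (Set.Ioi 0))
      Filter.atTop := by
    simp_rw [one_div, mul_inv]
    exact tendsto_inv_nhdsGT_zero.const_mul_atTop (by positivity)
  have ht : Filter.Tendsto (fun t : ℝ ↦ (t : ℂ)) (nhdsWithin 0 (Set.Ioi 0)) (nhds 0) :=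
    (Complex.continuous_ofReal.tendsto' 0 0 (by simp)).mono_left nhdsWithin_le_nhds
  have hleft : Filter.Tendsto (fun t : ℝ ↦
      ∑ r ∈ range n, Complex.exp (Real.pi * Complex.I * (m / n * r ^ 2 + 2 * b * r)) *
        jacobiTheta₂ ((r / n : ℝ) : ℂ) (Complex.I * (1 / (n ^ 2 * t) : ℝ)))
      (nhdsWithin 0 (Set.Ioi 0)) (nhds (∑ r ∈ range n,
        Complex.exp (Real.pi * Complex.I * (m / n * r ^ 2 + 2 * b * r)) * 1)) := by
    refine tendsto_finsetSum _ fun r _ ↦ (tendsto_jacobiTheta₂_one _ ?_).const_mul _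
    refine hinf.congr fun t ↦ ?_
    rw [Complex.I_mul_im, Complex.ofReal_re]
  have hright : Filter.Tendsto (fun t : ℝ ↦
      1 / (-Complex.I * (m / n + Complex.I * t)) ^ (1 / 2 : ℂ) *
        (1 / (m / (m + n * t * Complex.I)) ^ (1 / 2 : ℂ) *
          ∑ r ∈ range m, Complex.exp (-(Real.pi * Complex.I * (n / m) * (r + b) ^ 2)) *
            jacobiTheta₂ (((r + b) / m : ℝ) : ℂ)
              (Complex.I * (1 / (n ^ 2 * t) : ℝ) - (1 / (m * n) : ℝ))))
      (nhdsWithin 0 (Set.Ioi 0)) (nhds (1 / (-Complex.I * (m / n : ℝ)) ^ (1 / 2 : ℂ) *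
        (1 / 1 * ∑ r ∈ range m,
          Complex.exp (-(Real.pi * Complex.I * (n / m) * (r + b) ^ 2)) * 1))) := by
    refine .mul ?_ (.mul ?_ ?_)
    · have hz : (-Complex.I * (m / n : ℝ)).im ≠ 0 := by
        simp only [neg_mul, Complex.neg_im, Complex.I_mul_im, Complex.ofReal_re, neg_ne_zero]
        positivity
      have hz0 : -Complex.I * (m / n : ℝ) ≠ 0 := fun h ↦ hz (by rw [h, Complex.zero_im])
      refine tendsto_const_nhds.div ?_ (fun h ↦ hz0 ((Complex.cpow_eq_zero_iff _ _).1 h).1)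
      refine Filter.Tendsto.cpow ?_ tendsto_const_nhds (Or.inr hz)
      refine .const_mul _ ?_
      have := (ht.const_mul Complex.I).const_add (m / n : ℂ)
      simpa using this
    · refine tendsto_const_nhds.div ?_ one_ne_zero
      have h1 : Filter.Tendsto (fun t : ℝ ↦ (m : ℂ) / (m + n * t * Complex.I))
          (nhdsWithin 0 (Set.Ioi 0)) (nhds 1) := by
        have h2 := ((ht.const_mul (n : ℂ)).mul_const Complex.I).const_add (m : ℂ)
        have h3 := (tendsto_const_nhds (x := (m : ℂ))).div h2 (by simpa using hm0)
        simpa [Pi.div_def, hm0] using h3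
      have := h1.cpow (tendsto_const_nhds (x := (1 / 2 : ℂ))) Complex.one_mem_slitPlane
      rwa [Complex.one_cpow] at this
    · refine tendsto_finsetSum _ fun r _ ↦ (tendsto_jacobiTheta₂_one _ ?_).const_mul _
      refine hinf.congr fun t ↦ ?_
      rw [Complex.sub_im, Complex.I_mul_im, Complex.ofReal_re, Complex.ofReal_im, sub_zero]
  have h := tendsto_nhds_unique (hleft.congr' ?_) hright
  · rw [Complex.one_div_neg_I_mul_cpow_half (by positivity)] at h
    have e : 1 / (2 * ((m : ℝ) / n)) = n / (2 * m) := by field_simp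
    simpa only [mul_one, one_mul, div_one, e] using h
  · filter_upwards [self_mem_nhdsWithin] with t ht
    exact sum_cexp_mul_jacobiTheta₂_reciprocity hm hn hb heven ht

theorem stmt_13 (m n : ℕ) (hm : 0 < m) (hn : 0 < n) (ψ φ : ℤ) (hφ : φ ≠ 0)
    (heven : Even (n * m)) (hdvd : φ ∣ (n : ℤ) * ψ) :
    ∑ l ∈ Finset.range n,
        Complex.exp (2 * (Real.pi : ℂ) * Complex.I * m * l ^ 2 / (2 * n)) *
          Complex.exp (2 * (Real.pi : ℂ) * Complex.I * ψ * l / φ) =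
      (1 + Complex.I) * (Real.sqrt ((n : ℝ) / (2 * m)) : ℂ) *
        ∑ l ∈ Finset.range m,
          Complex.exp (-(2 * (Real.pi : ℂ) * Complex.I) * n * ((l : ℂ) * φ + ψ) ^ 2 /
            (2 * m * φ ^ 2)) := by
  obtain ⟨q, hq⟩ := hdvd
  have hφR : (φ : ℝ) ≠ 0 := by exact_mod_cast hφ
  have hφC : (φ : ℂ) ≠ 0 := by exact_mod_cast hφ
  have hn0 : (n : ℂ) ≠ 0 := by exact_mod_cast hn.ne'
  have hm0 : (m : ℂ) ≠ 0 := by exact_mod_cast hm.ne'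
  have hb : (n : ℝ) * (ψ / φ : ℝ) = q := by
    have : (n : ℝ) * ψ = φ * q := by exact_mod_cast hq
    field_simp
    exact this
  convert sum_cexp_quadratic_reciprocity hm hn hb heven using 1
  · refine sum_congr rfl fun l _ ↦ ?_
    rw [← Complex.exp_add]
    congr 1
    push_cast
    field_simp
  · congr 1
    refine sum_congr rfl fun l _ ↦ ?_
    congr 1
    push_cast
    field_simp
end
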